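/- arXiv:1407.7921 — 3 statements merged into one kernel-verified Lean document; each statement's English description precedes it below -/
import Mathlib

section
/- Let L be the Laplacian of a weight-balanced weighted digraph on N vertices and Sym(L) = (L + Lᵀ)/2 its symmetric part, with eigenvalues ordered λ₁ = 0 ≤ λ₂ ≤ … ≤ λ_N. Then for every x ∈ ℝᴺ, λ₂ · xᵀ L x ≤ xᵀ Sym(L)² x ≤ λ_N · xᵀ L x. -/
open Matrix Finset

namespace Matrix.IsHermitian

variable {n : Type*} [Fintype n] [DecidableEq n] {A : Matrix n n ℝ} (hA : A.IsHermitian)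

/-- Parseval's identity in the eigenvector basis of a real symmetric matrix. -/
theorem dotProduct_eq_sum_eigenvectorBasis (x y : n → ℝ) :
    x ⬝ᵥ y = ∑ i, (⇑(hA.eigenvectorBasis i) ⬝ᵥ x) * (⇑(hA.eigenvectorBasis i) ⬝ᵥ y) := by
  have h := hA.eigenvectorBasis.sum_inner_mul_inner (WithLp.toLp 2 x) (WithLp.toLp 2 y)
  simp only [EuclideanSpace.inner_eq_star_dotProduct, star_trivial] at h
  rw [dotProduct_comm x y, ← h]
  exact Finset.sum_congr rfl fun i _ => by rw [dotProduct_comm y]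

theorem eigenvectorBasis_dotProduct_mulVec (i : n) (x : n → ℝ) :
    ⇑(hA.eigenvectorBasis i) ⬝ᵥ A *ᵥ x =
      hA.eigenvalues i * (⇑(hA.eigenvectorBasis i) ⬝ᵥ x) := by
  have hT : Aᵀ = A := by simpa [conjTranspose_eq_transpose_of_trivial] using hA.eq
  rw [dotProduct_mulVec, ← mulVec_transpose, hT, hA.mulVec_eigenvectorBasis, smul_dotProduct,
    smul_eq_mul]

theorem dotProduct_mulVec_eq_sum (x : n → ℝ) :
    x ⬝ᵥ A *ᵥ x = ∑ i, hA.eigenvalues i * (⇑(hA.eigenvectorBasis i) ⬝ᵥ x) ^ 2 := by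
  rw [hA.dotProduct_eq_sum_eigenvectorBasis]
  refine Finset.sum_congr rfl fun i _ => ?_
  rw [hA.eigenvectorBasis_dotProduct_mulVec]
  ring

theorem dotProduct_mul_self_mulVec_eq_sum (x : n → ℝ) :
    x ⬝ᵥ (A * A) *ᵥ x = ∑ i, hA.eigenvalues i ^ 2 * (⇑(hA.eigenvectorBasis i) ⬝ᵥ x) ^ 2 := by
  rw [hA.dotProduct_eq_sum_eigenvectorBasis]
  refine Finset.sum_congr rfl fun i _ => ?_
  rw [← mulVec_mulVec, hA.eigenvectorBasis_dotProduct_mulVec,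
    hA.eigenvectorBasis_dotProduct_mulVec]
  ring

end Matrix.IsHermitian

/-- A real square matrix and its symmetric part define the same quadratic form. -/
theorem dotProduct_symmetricPart_mulVec {n : Type*} [Fintype n] (A : Matrix n n ℝ) (x : n → ℝ) :
    x ⬝ᵥ ((1 / 2 : ℝ) • (A + Aᵀ)) *ᵥ x = x ⬝ᵥ A *ᵥ x := by
  have h : x ⬝ᵥ Aᵀ *ᵥ x = x ⬝ᵥ A *ᵥ x := by
    rw [mulVec_transpose, dotProduct_comm, dotProduct_mulVec]
  rw [smul_mulVec, add_mulVec, dotProduct_smul, dotProduct_add, h, smul_eq_mul]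
  ring

/-- For the Laplacian `L` of a weight-balanced digraph, with the eigenvalues
of `Sym(L) = (L + Lᵀ)/2` ordered as `λ₁ = 0 ≤ λ₂ ≤ … ≤ λ_N` (here `μ` is a monotone
enumeration of the eigenvalues, up to a permutation `π`, with `μ 0 = 0`), one has
`λ₂ xᵀ L x ≤ xᵀ Sym(L)² x ≤ λ_N xᵀ L x` for every `x ∈ ℝᴺ`. -/
theorem symmetrized_laplacian_squared_quadratic_bounds
    (N : ℕ) (hN : 1 < N) (W : Matrix (Fin N) (Fin N) ℝ)
    (hWnn : ∀ i j, 0 ≤ W i j) (hWdiag : ∀ i, W i i = 0)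
    (hbal : ∀ i, ∑ j, W i j = ∑ j, W j i)
    (L : Matrix (Fin N) (Fin N) ℝ)
    (hL : L = Matrix.diagonal (fun i => ∑ k, W i k) - W)
    (S : Matrix (Fin N) (Fin N) ℝ) (hS : S = (1/2 : ℝ) • (L + Lᵀ))
    (hherm : S.IsHermitian)
    (μ : Fin N → ℝ) (hmono : Monotone μ) (π : Equiv.Perm (Fin N))
    (hμ : ∀ k, μ k = hherm.eigenvalues (π k))
    (hμ0 : μ ⟨0, by omega⟩ = 0) :
    ∀ x : Fin N → ℝ,
      μ ⟨1, hN⟩ * (x ⬝ᵥ L.mulVec x) ≤ x ⬝ᵥ (S * S).mulVec x ∧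
      x ⬝ᵥ (S * S).mulVec x ≤ μ ⟨N - 1, by omega⟩ * (x ⬝ᵥ L.mulVec x) := by
  intro x
  have hquad : x ⬝ᵥ L *ᵥ x = x ⬝ᵥ S *ᵥ x := by
    rw [hS, dotProduct_symmetricPart_mulVec]
  have heig : ∀ i, hherm.eigenvalues i = μ (π.symm i) := fun i => by simp [hμ]
  have hnonneg : ∀ k, 0 ≤ μ k := fun k => hμ0 ▸ hmono (Fin.mk_le_of_le_val (Nat.zero_le _))
  have hlower : ∀ k, μ ⟨1, hN⟩ * μ k ≤ μ k ^ 2 := fun k => by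
    by_cases hk : k = ⟨0, by omega⟩
    · simp [hk, hμ0]
    · have hk1 : μ ⟨1, hN⟩ ≤ μ k := hmono <| Fin.mk_le_of_le_val <|
        Nat.one_le_iff_ne_zero.mpr fun h => hk (Fin.ext h)
      rw [sq]
      exact mul_le_mul_of_nonneg_right hk1 (hnonneg k)
  have hupper : ∀ k, μ k ^ 2 ≤ μ ⟨N - 1, by omega⟩ * μ k := fun k => by
    rw [sq]
    exact mul_le_mul_of_nonneg_right (hmono (Fin.le_def.mpr (Nat.le_sub_one_of_lt k.isLt)))
      (hnonneg k)
  rw [hquad, hherm.dotProduct_mulVec_eq_sum, hherm.dotProduct_mul_self_mulVec_eq_sum,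
    Finset.mul_sum, Finset.mul_sum]
  constructor <;> refine Finset.sum_le_sum fun i _ => ?_ <;> rw [← mul_assoc, heig]
  · exact mul_le_mul_of_nonneg_right (hlower _) (sq_nonneg _)
  · exact mul_le_mul_of_nonneg_right (hupper _) (sq_nonneg _)
end

section
/- (Evolution of network disagreement, Proposition 1.) Let L be the Laplacian of a weight-balanced weighted digraph on N vertices with weights wᵢⱼ. For each i let aᵢ > 0. Then for all x̂, e ∈ ℝᴺ, −x̂ᵀ L x̂ + eᵀ L x̂ ≤ −(1/2) Σ_{i=1}^N Σ_{j=1}^N wᵢⱼ [ (1 − aᵢ)(x̂ᵢ − x̂ⱼ)² − eᵢ²/aᵢ ]. Consequently, if x : ℝ → ℝᴺ satisfies ẋ(t) = −L x̂ at a time t where x(t) = x̂ − e, then the derivative of V(x) = (1/2)(x − x̄)ᵀ(x − x̄) at t (with x̄ = (1/N)(𝟙ᴺᵀ x(t))𝟙ᴺ) is bounded above by the same right-hand side. -/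
open Matrix Finset

section WeightedDigraph

variable {ι : Type*} [Fintype ι]

/-- The Laplacian acts by weighted differences along the edges. -/
lemma laplacian_mulVec_apply [DecidableEq ι] (W : Matrix ι ι ℝ) (v : ι → ℝ) (i : ι) :
    ((Matrix.diagonal (fun i => ∑ k, W i k) - W).mulVec v) i = ∑ j, W i j * (v i - v j) := by
  rw [Matrix.sub_mulVec, Pi.sub_apply, Matrix.mulVec_diagonal]
  simp only [Matrix.mulVec, dotProduct, mul_sub, Finset.sum_sub_distrib, Finset.sum_mul]

/-- In a weight-balanced digraph, summing a vertex function over the tails of the edges gives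
the same result as summing it over the heads. -/
lemma sum_weight_tail_eq_sum_weight_head {W : Matrix ι ι ℝ}
    (hbal : ∀ i, ∑ j, W i j = ∑ j, W j i) (f : ι → ℝ) :
    ∑ i, ∑ j, W i j * f i = ∑ i, ∑ j, W i j * f j := by
  rw [Finset.sum_comm (f := fun i j => W i j * f j)]
  simp only [← Finset.sum_mul, hbal]

/-- The components of `L v` sum to zero in a weight-balanced digraph. -/
lemma sum_laplacian_mulVec_eq_zero [DecidableEq ι] {W : Matrix ι ι ℝ}
    (hbal : ∀ i, ∑ j, W i j = ∑ j, W j i) (v : ι → ℝ) :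
    ∑ i, ((Matrix.diagonal (fun i => ∑ k, W i k) - W).mulVec v) i = 0 := by
  simp only [laplacian_mulVec_apply, mul_sub, Finset.sum_sub_distrib]
  rw [sum_weight_tail_eq_sum_weight_head hbal, sub_self]

/-- The quadratic form of the Laplacian of a weight-balanced digraph is half the weighted sum of
the squared differences along the edges. -/
lemma dotProduct_laplacian_mulVec [DecidableEq ι] {W : Matrix ι ι ℝ}
    (hbal : ∀ i, ∑ j, W i j = ∑ j, W j i) (v : ι → ℝ) :
    v ⬝ᵥ (Matrix.diagonal (fun i => ∑ k, W i k) - W).mulVec v =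
      ∑ i, ∑ j, W i j * ((v i - v j) ^ 2 / 2) := by
  have hsplit : v ⬝ᵥ (Matrix.diagonal (fun i => ∑ k, W i k) - W).mulVec v =
      ∑ i, ∑ j, W i j * ((v i - v j) ^ 2 / 2) +
        (∑ i, ∑ j, W i j * (v i ^ 2 / 2) - ∑ i, ∑ j, W i j * (v j ^ 2 / 2)) := by
    simp only [dotProduct, laplacian_mulVec_apply, Finset.mul_sum, ← Finset.sum_sub_distrib,
      ← Finset.sum_add_distrib]
    refine Finset.sum_congr rfl fun i _ => Finset.sum_congr rfl fun j _ => ?_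
    ring
  rw [hsplit, sum_weight_tail_eq_sum_weight_head hbal fun i => v i ^ 2 / 2, sub_self, add_zero]

/-- Young's inequality `e d ≤ (a d² + e² / a) / 2`. -/
lemma mul_le_half_mul_sq_add_sq_div {a : ℝ} (ha : 0 < a) (e d : ℝ) :
    e * d ≤ (a * d ^ 2 + e ^ 2 / a) / 2 := by
  have hsq : (a * d ^ 2 + e ^ 2 / a) / 2 - e * d = (a * d - e) ^ 2 / (2 * a) := by
    field_simp
    ring
  have hnn : 0 ≤ (a * d - e) ^ 2 / (2 * a) := by positivity
  linarith

/-- The bound on the decay rate of the disagreement in terms of the broadcast states and errors. -/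
lemma neg_dotProduct_laplacian_add_le [DecidableEq ι] {W : Matrix ι ι ℝ}
    (hWnn : ∀ i j, 0 ≤ W i j) (hbal : ∀ i, ∑ j, W i j = ∑ j, W j i)
    {a : ι → ℝ} (ha : ∀ i, 0 < a i) (v e : ι → ℝ) :
    -(v ⬝ᵥ (Matrix.diagonal (fun i => ∑ k, W i k) - W).mulVec v) +
        e ⬝ᵥ (Matrix.diagonal (fun i => ∑ k, W i k) - W).mulVec v ≤
      -(1/2) * ∑ i, ∑ j, W i j * ((1 - a i) * (v i - v j) ^ 2 - e i ^ 2 / a i) := by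
  rw [dotProduct_laplacian_mulVec hbal]
  simp only [dotProduct, laplacian_mulVec_apply, Finset.mul_sum, ← Finset.sum_neg_distrib,
    ← Finset.sum_add_distrib]
  refine Finset.sum_le_sum fun i _ => Finset.sum_le_sum fun j _ => ?_
  have hyoung := mul_le_mul_of_nonneg_left
    (mul_le_half_mul_sq_add_sq_div (ha i) (e i) (v i - v j)) (hWnn i j)
  linarith

end WeightedDigraph

/-- The derivative of half the squared distance to a fixed vector `c 𝟙`. -/
lemma hasDerivAt_half_sum_sub_sq {ι : Type*} [Fintype ι] {x : ℝ → ι → ℝ} {x' : ι → ℝ} {t : ℝ}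
    (hx : ∀ i, HasDerivAt (fun s => x s i) (x' i) t) (c : ℝ) :
    HasDerivAt (fun s => (1/2) * ∑ i, (x s i - c) ^ 2) (∑ i, (x t i - c) * x' i) t := by
  have h := (HasDerivAt.fun_sum (u := Finset.univ)
    fun i _ => ((hx i).sub_const c).fun_pow 2).const_mul (1/2 : ℝ)
  refine h.congr_deriv ?_
  rw [Finset.mul_sum]
  refine Finset.sum_congr rfl fun i _ => ?_
  norm_num
  ring

/-- Proposition 1, evolution of network disagreement: for a weight-balanced
digraph with Laplacian `L`, constants `aᵢ > 0`, and any `x̂, e ∈ ℝᴺ`,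
`-x̂ᵀ L x̂ + eᵀ L x̂ ≤ -(1/2) ∑ᵢ ∑ⱼ wᵢⱼ [(1 - aᵢ)(x̂ᵢ - x̂ⱼ)² - eᵢ²/aᵢ]`.
Consequently, if `x : ℝ → ℝᴺ` satisfies `ẋ(t) = -L x̂` at a time `t` where `x(t) = x̂ - e`,
then the derivative `D` at `t` of `V(x) = (1/2)(x - x̄)ᵀ(x - x̄)`,
with `x̄ = (1/N)(𝟙ᵀ x(t))𝟙`, is bounded above by the same right-hand side. -/
theorem network_disagreement_evolution
    (N : ℕ) (W : Matrix (Fin N) (Fin N) ℝ)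
    (hWnn : ∀ i j, 0 ≤ W i j) (hWdiag : ∀ i, W i i = 0)
    (hbal : ∀ i, ∑ j, W i j = ∑ j, W j i)
    (L : Matrix (Fin N) (Fin N) ℝ)
    (hL : L = Matrix.diagonal (fun i => ∑ k, W i k) - W)
    (a : Fin N → ℝ) (ha : ∀ i, 0 < a i)
    (xhat e : Fin N → ℝ)
    (x : ℝ → Fin N → ℝ) (t : ℝ)
    (hx : ∀ i, HasDerivAt (fun s => x s i) (-(L.mulVec xhat) i) t)
    (hxt : ∀ i, x t i = xhat i - e i)
    (D : ℝ)
    (hD : HasDerivAt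
      (fun s => (1/2) * ∑ i, (x s i - (1 / (N : ℝ)) * ∑ j, x t j)^2) D t) :
    (-(xhat ⬝ᵥ L.mulVec xhat) + e ⬝ᵥ L.mulVec xhat
        ≤ -(1/2) * ∑ i, ∑ j, W i j * ((1 - a i) * (xhat i - xhat j)^2 - (e i)^2 / a i)) ∧
    D ≤ -(1/2) * ∑ i, ∑ j, W i j * ((1 - a i) * (xhat i - xhat j)^2 - (e i)^2 / a i) := by
  subst hL
  have hbound := neg_dotProduct_laplacian_add_le hWnn hbal ha xhat e
  refine ⟨hbound, le_of_eq_of_le ?_ hbound⟩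
  have hzero := sum_laplacian_mulVec_eq_zero hbal xhat
  rw [hD.unique (hasDerivAt_half_sum_sub_sq hx _)]
  generalize (1 / (N : ℝ)) * ∑ j, x t j = c
  generalize (Matrix.diagonal (fun i => ∑ k, W i k) - W).mulVec xhat = u at hzero ⊢
  calc ∑ i, (x t i - c) * -u i
      = -(xhat ⬝ᵥ u) + e ⬝ᵥ u + c * ∑ i, u i := by
        simp only [dotProduct, Finset.mul_sum, ← Finset.sum_neg_distrib, ← Finset.sum_add_distrib]
        refine Finset.sum_congr rfl fun i _ => ?_
        rw [hxt i]
        ring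
    _ = -(xhat ⬝ᵥ u) + e ⬝ᵥ u := by rw [hzero, mul_zero, add_zero]
end

section
/- (Inter-event time lower bound, core of the no-Zeno proposition.) Let i be a vertex of a weighted digraph with nonnegative weights wᵢⱼ, nonempty out-neighbor set 𝒩ᵢ = {j : wᵢⱼ > 0}, out-degree dᵢ = Σ_{j∈𝒩ᵢ} wᵢⱼ, w_i^max = max_{j∈𝒩ᵢ} wᵢⱼ, and let σᵢ ∈ (0,1). Let x̂ ∈ ℝᴺ and set ẑᵢ = Σ_{j∈𝒩ᵢ} wᵢⱼ(x̂ⱼ − x̂ᵢ). If ẑᵢ ≠ 0 and τ ≥ 0 satisfies τ² ẑᵢ² = (σᵢ/(4dᵢ)) Σ_{j∈𝒩ᵢ} wᵢⱼ (x̂ᵢ − x̂ⱼ)², then τ ≥ √( σᵢ / (4 dᵢ w_i^max |𝒩ᵢ|) ) > 0. -/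
open Matrix Finset

/-- The square of a weighted sum is at most the number of terms times a bound on the weights times
the weighted sum of squares. -/
theorem sq_sum_mul_le_card_mul_sum_mul_sq {ι : Type*} (s : Finset ι) (w y : ι → ℝ) (m : ℝ)
    (hw : ∀ j ∈ s, 0 ≤ w j) (hm : ∀ j ∈ s, w j ≤ m) :
    (∑ j ∈ s, w j * y j) ^ 2 ≤ m * s.card * ∑ j ∈ s, w j * y j ^ 2 := by
  calc (∑ j ∈ s, w j * y j) ^ 2 ≤ s.card * ∑ j ∈ s, (w j * y j) ^ 2 := sq_sum_le_card_mul_sum_sq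
    _ ≤ s.card * ∑ j ∈ s, m * (w j * y j ^ 2) := by
        gcongr with j hj
        calc (w j * y j) ^ 2 = w j * (w j * y j ^ 2) := by ring
          _ ≤ m * (w j * y j ^ 2) :=
            mul_le_mul_of_nonneg_right (hm j hj) (mul_nonneg (hw j hj) (sq_nonneg _))
    _ = m * s.card * ∑ j ∈ s, w j * y j ^ 2 := by rw [← mul_sum]; ring

/-- inter-event time lower bound, core of the no-Zeno proposition:
for a vertex `i` with nonempty out-neighbor set `𝒩ᵢ = {j : wᵢⱼ > 0}`, out-degree
`dᵢ = ∑_{j∈𝒩ᵢ} wᵢⱼ`, `wᵢ^max = max_{j∈𝒩ᵢ} wᵢⱼ`, `σᵢ ∈ (0,1)`,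
and `ẑᵢ = ∑_{j∈𝒩ᵢ} wᵢⱼ(x̂ⱼ - x̂ᵢ)`: if `ẑᵢ ≠ 0` and `τ ≥ 0` satisfies
`τ² ẑᵢ² = (σᵢ/(4dᵢ)) ∑_{j∈𝒩ᵢ} wᵢⱼ(x̂ᵢ - x̂ⱼ)²`, then
`τ ≥ √(σᵢ/(4 dᵢ wᵢ^max |𝒩ᵢ|)) > 0`. -/
theorem interevent_time_lower_bound
    (N : ℕ) (W : Matrix (Fin N) (Fin N) ℝ)
    (hWnn : ∀ a b, 0 ≤ W a b) (hWdiag : ∀ a, W a a = 0)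
    (i : Fin N)
    (hne : (Finset.univ.filter (fun j => 0 < W i j)).Nonempty)
    (σi : ℝ) (hσi : σi ∈ Set.Ioo (0 : ℝ) 1)
    (xhat : Fin N → ℝ)
    (d z wmax : ℝ)
    (hd : d = ∑ j ∈ Finset.univ.filter (fun j => 0 < W i j), W i j)
    (hz : z = ∑ j ∈ Finset.univ.filter (fun j => 0 < W i j), W i j * (xhat j - xhat i))
    (hwmax : wmax = (Finset.univ.filter (fun j => 0 < W i j)).sup' hne (fun j => W i j))
    (hzne : z ≠ 0)
    (τ : ℝ) (hτnn : 0 ≤ τ)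
    (hτ : τ^2 * z^2 =
      σi / (4 * d) * ∑ j ∈ Finset.univ.filter (fun j => 0 < W i j),
        W i j * (xhat i - xhat j)^2) :
    Real.sqrt (σi / (4 * d * wmax *
        ((Finset.univ.filter (fun j => 0 < W i j)).card : ℝ))) ≤ τ ∧
    0 < Real.sqrt (σi / (4 * d * wmax *
        ((Finset.univ.filter (fun j => 0 < W i j)).card : ℝ))) := by
  set s := Finset.univ.filter (fun j => 0 < W i j)
  have hpos : ∀ j ∈ s, 0 < W i j := fun j hj => (mem_filter.mp hj).2
  have hle : ∀ j ∈ s, W i j ≤ wmax := fun j hj => hwmax ▸ le_sup' (fun j => W i j) hj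
  have hd0 : 0 < d := hd ▸ sum_pos hpos hne
  have hm0 : 0 < wmax := by
    obtain ⟨j, hj⟩ := hne
    exact (hpos j hj).trans_le (hle j hj)
  have hc0 : (0 : ℝ) < s.card := by exact_mod_cast hne.card_pos
  have hσ0 : 0 < σi := hσi.1
  have hz2 : z ^ 2 ≤ wmax * s.card * ∑ j ∈ s, W i j * (xhat i - xhat j) ^ 2 := by
    simp_rw [sub_sq_comm (xhat i)]
    exact hz ▸ sq_sum_mul_le_card_mul_sum_mul_sq s (W i) _ wmax (fun j hj => (hpos j hj).le) hle
  refine ⟨Real.sqrt_le_iff.mpr ⟨hτnn, ?_⟩, Real.sqrt_pos.mpr (by positivity)⟩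
  refine le_of_mul_le_mul_right ?_ (sq_pos_of_ne_zero hzne)
  calc σi / (4 * d * wmax * s.card) * z ^ 2
      ≤ σi / (4 * d * wmax * s.card) *
          (wmax * s.card * ∑ j ∈ s, W i j * (xhat i - xhat j) ^ 2) := by gcongr
    _ = τ ^ 2 * z ^ 2 := by rw [hτ]; field_simp
end
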